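/- In the equitable algebra U, for i ≠ j one has Σ_{r=0}^{1-A_ij} (-1)^r [1-A_ij choose r]_i (1 - X_iZ_i)^{1-A_ij-r} (1 - X_jZ_j) (1 - X_iZ_i)^{r} = 0. -/

import Mathlib

open FreeAlgebra
open scoped TensorProduct

noncomputable section

/-- The field `𝕂(q)` of rational functions in the indeterminate `q` over `𝕂`. -/
abbrev Kq (K : Type) [Field K] : Type := RatFunc K

/-- The indeterminate `q` viewed as an element of `𝕂(q)`. -/
def qv (K : Type) [Field K] : Kq K := RatFunc.X

/-- `q_i = q^{d_i}`, given the exponent `di = d_i`. -/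
def qi (K : Type) [Field K] (di : ℕ) : Kq K := qv K ^ di

/-- The quantum integer `[m]_i = (q_i^m - q_i^{-m})/(q_i - q_i⁻¹)`. -/
def qnum (K : Type) [Field K] (di : ℕ) (m : ℤ) : Kq K :=
  (qi K di ^ m - qi K di ^ (-m)) / (qi K di - (qi K di)⁻¹)

/-- The quantum factorial `[m]_i! = [m]_i [m-1]_i ⋯ [1]_i`, with `[0]_i! = 1`. -/
def qfac (K : Type) [Field K] (di : ℕ) : ℕ → Kq K
  | 0 => 1
  | m + 1 => qnum K di (m + 1) * qfac K di m

/-- The Gaussian binomial coefficient `[m choose r]_i = [m]_i!/([r]_i![m-r]_i!)`. -/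
def qbin (K : Type) [Field K] (di m r : ℕ) : Kq K :=
  qfac K di m / (qfac K di r * qfac K di (m - r))

/-- Chevalley generators `E_i, F_i, K_i, K_i⁻¹` of `U_q(g)`. -/
inductive CGen (n : ℕ) : Type
  | E : Fin n → CGen n
  | F : Fin n → CGen n
  | K : Fin n → CGen n
  | Kinv : Fin n → CGen n

/-- The defining relations (R1)–(R7) of `U_q(g)` in the Chevalley presentation. -/
inductive CRel (K : Type) [Field K] {n : ℕ} (A : Matrix (Fin n) (Fin n) ℤ) (d : Fin n → ℕ) :
    FreeAlgebra (Kq K) (CGen n) → FreeAlgebra (Kq K) (CGen n) → Prop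
  | R1a (i : Fin n) : CRel K A d (ι (Kq K) (CGen.K i) * ι (Kq K) (CGen.Kinv i)) 1
  | R1b (i : Fin n) : CRel K A d (ι (Kq K) (CGen.Kinv i) * ι (Kq K) (CGen.K i)) 1
  | R2 (i j : Fin n) : CRel K A d (ι (Kq K) (CGen.K i) * ι (Kq K) (CGen.K j))
      (ι (Kq K) (CGen.K j) * ι (Kq K) (CGen.K i))
  | R3 (i j : Fin n) : CRel K A d
      (ι (Kq K) (CGen.K i) * ι (Kq K) (CGen.E j) * ι (Kq K) (CGen.Kinv i))
      (qi K (d i) ^ (A i j) • ι (Kq K) (CGen.E j))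
  | R4 (i j : Fin n) : CRel K A d
      (ι (Kq K) (CGen.K i) * ι (Kq K) (CGen.F j) * ι (Kq K) (CGen.Kinv i))
      (qi K (d i) ^ (-(A i j)) • ι (Kq K) (CGen.F j))
  | R5 (i j : Fin n) : CRel K A d
      (ι (Kq K) (CGen.E i) * ι (Kq K) (CGen.F j) - ι (Kq K) (CGen.F j) * ι (Kq K) (CGen.E i))
      (if i = j then (qi K (d i) - (qi K (d i))⁻¹)⁻¹ •
        (ι (Kq K) (CGen.K i) - ι (Kq K) (CGen.Kinv i)) else 0)
  | R6 (i j : Fin n) (hij : i ≠ j) : CRel K A d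
      (∑ r ∈ Finset.range ((1 - A i j).toNat + 1),
        ((-1 : Kq K) ^ r * qbin K (d i) (1 - A i j).toNat r) •
          (ι (Kq K) (CGen.E i) ^ ((1 - A i j).toNat - r) * ι (Kq K) (CGen.E j) *
            ι (Kq K) (CGen.E i) ^ r)) 0
  | R7 (i j : Fin n) (hij : i ≠ j) : CRel K A d
      (∑ r ∈ Finset.range ((1 - A i j).toNat + 1),
        ((-1 : Kq K) ^ r * qbin K (d i) (1 - A i j).toNat r) •
          (ι (Kq K) (CGen.F i) ^ ((1 - A i j).toNat - r) * ι (Kq K) (CGen.F j) *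
            ι (Kq K) (CGen.F i) ^ r)) 0

/-- The quantum group `U_q(g)` presented by generators and relations (R1)–(R7). -/
abbrev Uqg (K : Type) [Field K] {n : ℕ} (A : Matrix (Fin n) (Fin n) ℤ) (d : Fin n → ℕ) :=
  RingQuot (CRel K A d)

variable (K : Type) [Field K] {n : ℕ} (A : Matrix (Fin n) (Fin n) ℤ) (d : Fin n → ℕ)

def genE (i : Fin n) : Uqg K A d := RingQuot.mkAlgHom (Kq K) (CRel K A d) (ι (Kq K) (CGen.E i))
def genF (i : Fin n) : Uqg K A d := RingQuot.mkAlgHom (Kq K) (CRel K A d) (ι (Kq K) (CGen.F i))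
def genK (i : Fin n) : Uqg K A d := RingQuot.mkAlgHom (Kq K) (CRel K A d) (ι (Kq K) (CGen.K i))
def genKinv (i : Fin n) : Uqg K A d :=
  RingQuot.mkAlgHom (Kq K) (CRel K A d) (ι (Kq K) (CGen.Kinv i))

/-- Equitable generators `X_i, X_i⁻¹, Y_i, Z_i`. -/
inductive EGen (n : ℕ) : Type
  | X : Fin n → EGen n
  | Xinv : Fin n → EGen n
  | Y : Fin n → EGen n
  | Z : Fin n → EGen n

/-- The defining relations (E1)–(E8) of the equitable presentation. -/
inductive ERel (K : Type) [Field K] {n : ℕ} (A : Matrix (Fin n) (Fin n) ℤ) (d : Fin n → ℕ) :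
    FreeAlgebra (Kq K) (EGen n) → FreeAlgebra (Kq K) (EGen n) → Prop
  | E1a (i : Fin n) : ERel K A d (ι (Kq K) (EGen.X i) * ι (Kq K) (EGen.Xinv i)) 1
  | E1b (i : Fin n) : ERel K A d (ι (Kq K) (EGen.Xinv i) * ι (Kq K) (EGen.X i)) 1
  | E2 (i j : Fin n) : ERel K A d (ι (Kq K) (EGen.X i) * ι (Kq K) (EGen.X j))
      (ι (Kq K) (EGen.X j) * ι (Kq K) (EGen.X i))
  | E3 (i j : Fin n) : ERel K A d
      (ι (Kq K) (EGen.Y i) * ι (Kq K) (EGen.X j) -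
        qi K (d i) ^ (A i j) • (ι (Kq K) (EGen.X j) * ι (Kq K) (EGen.Y i)))
      ((1 - qi K (d i) ^ (A i j)) • (ι (Kq K) (EGen.Xinv i) * ι (Kq K) (EGen.X j)))
  | E4 (i j : Fin n) : ERel K A d
      (ι (Kq K) (EGen.X i) * ι (Kq K) (EGen.Z j) -
        qi K (d i) ^ (A i j) • (ι (Kq K) (EGen.Z j) * ι (Kq K) (EGen.X i)))
      ((1 - qi K (d i) ^ (A i j)) • (ι (Kq K) (EGen.X i) * ι (Kq K) (EGen.Xinv j)))
  | E5 (i : Fin n) : ERel K A d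
      (ι (Kq K) (EGen.Z i) * ι (Kq K) (EGen.Y i) -
        (qi K (d i) ^ 2) • (ι (Kq K) (EGen.Y i) * ι (Kq K) (EGen.Z i)))
      ((1 - qi K (d i) ^ 2) • 1)
  | E6 (i j : Fin n) (hij : i ≠ j) : ERel K A d
      (ι (Kq K) (EGen.Z i) * ι (Kq K) (EGen.Y j) -
        qi K (d i) ^ (A i j) • (ι (Kq K) (EGen.Y j) * ι (Kq K) (EGen.Z i)))
      ((1 - qi K (d i) ^ (A i j)) • (ι (Kq K) (EGen.Xinv i) * ι (Kq K) (EGen.Xinv j)))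
  | E7 (i j : Fin n) (hij : i ≠ j) : ERel K A d
      (∑ r ∈ Finset.range ((1 - A i j).toNat + 1),
        ((-1 : Kq K) ^ r * qbin K (d i) (1 - A i j).toNat r) •
          (ι (Kq K) (EGen.Y i) ^ ((1 - A i j).toNat - r) * ι (Kq K) (EGen.Y j) *
            ι (Kq K) (EGen.Y i) ^ r))
      ((∏ s ∈ Finset.range ((-(A i j)).toNat + 1), (1 - qi K (d i) ^ (A i j + 2 * (s : ℤ)))) •
        (ι (Kq K) (EGen.Xinv i) ^ (1 - A i j).toNat * ι (Kq K) (EGen.Xinv j)))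
  | E8 (i j : Fin n) (hij : i ≠ j) : ERel K A d
      (∑ r ∈ Finset.range ((1 - A i j).toNat + 1),
        ((-1 : Kq K) ^ r * qbin K (d i) (1 - A i j).toNat r) •
          (ι (Kq K) (EGen.Z i) ^ ((1 - A i j).toNat - r) * ι (Kq K) (EGen.Z j) *
            ι (Kq K) (EGen.Z i) ^ r))
      ((∏ s ∈ Finset.range ((-(A i j)).toNat + 1), (1 - qi K (d i) ^ (A i j + 2 * (s : ℤ)))) •
        (ι (Kq K) (EGen.Xinv i) ^ (1 - A i j).toNat * ι (Kq K) (EGen.Xinv j)))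

/-- The equitable algebra `U` presented by generators and relations (E1)–(E8). -/
abbrev Ueqg (K : Type) [Field K] {n : ℕ} (A : Matrix (Fin n) (Fin n) ℤ) (d : Fin n → ℕ) :=
  RingQuot (ERel K A d)

def genX (i : Fin n) : Ueqg K A d := RingQuot.mkAlgHom (Kq K) (ERel K A d) (ι (Kq K) (EGen.X i))
def genXinv (i : Fin n) : Ueqg K A d :=
  RingQuot.mkAlgHom (Kq K) (ERel K A d) (ι (Kq K) (EGen.Xinv i))
def genY (i : Fin n) : Ueqg K A d := RingQuot.mkAlgHom (Kq K) (ERel K A d) (ι (Kq K) (EGen.Y i))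
def genZ (i : Fin n) : Ueqg K A d := RingQuot.mkAlgHom (Kq K) (ERel K A d) (ι (Kq K) (EGen.Z i))

/-- `A` is a symmetrizable generalized Cartan matrix with symmetrizing positive,
relatively prime integers `d_i`, and `n ≥ 1`. -/
def IsSymmetrizableGCM {n : ℕ} (A : Matrix (Fin n) (Fin n) ℤ) (d : Fin n → ℕ) : Prop :=
  0 < n ∧ (∀ i, A i i = 2) ∧ (∀ i j, i ≠ j → A i j ≤ 0) ∧
    (∀ i, 0 < d i) ∧ Finset.univ.gcd d = 1 ∧
    (∀ i j, (d i : ℤ) * A i j = (d j : ℤ) * A j i)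

end

section TwistedCommutator

variable {F R : Type*} [Field F] [Ring R] [Algebra F R]

/-- The iterated twisted commutator `(L - b p^{t-1} R) ⋯ (L - b p R) (L - b R) w`, where `L` and `R`
are left and right multiplication by `a`. -/
def twistedAd (b p : F) (a : R) : ℕ → R → R
  | 0, w => w
  | t + 1, w => a * twistedAd b p a t w - (b * p ^ t) • (twistedAd b p a t w * a)

/-- The `r`-th elementary symmetric function of `1, p, …, p^{t-1}`. -/
def gaussCoeff (p : F) : ℕ → ℕ → F
  | _, 0 => 1
  | 0, _ + 1 => 0
  | t + 1, r + 1 => gaussCoeff p t (r + 1) + p ^ t * gaussCoeff p t r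

theorem gaussCoeff_zero_right (p : F) (t : ℕ) : gaussCoeff p t 0 = 1 := by
  cases t <;> rfl

theorem gaussCoeff_eq_zero (p : F) {t r : ℕ} (h : t < r) : gaussCoeff p t r = 0 := by
  induction t generalizing r with
  | zero => cases r with
    | zero => omega
    | succ r => rfl
  | succ t ih => cases r with
    | zero => omega
    | succ r => rw [gaussCoeff, ih (by omega), ih (by omega)]; simp

theorem twistedAd_eq_sum (b p : F) (a : R) (t : ℕ) (w : R) :
    twistedAd b p a t w = ∑ r ∈ Finset.range (t + 1),
      ((-1) ^ r * gaussCoeff p t r * b ^ r) • (a ^ (t - r) * w * a ^ r) := by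
  induction t with
  | zero => simp [twistedAd, gaussCoeff]
  | succ t ih =>
    have hl : a * twistedAd b p a t w = ∑ r ∈ Finset.range (t + 1 + 1),
        ((-1) ^ r * gaussCoeff p t r * b ^ r) • (a ^ (t + 1 - r) * w * a ^ r) := by
      rw [Finset.sum_range_succ, gaussCoeff_eq_zero p (Nat.lt_succ_self t), ih, Finset.mul_sum]
      simp only [mul_zero, zero_mul, zero_smul, add_zero]
      refine Finset.sum_congr rfl fun r hr => ?_
      have hr' : t + 1 - r = (t - r) + 1 := by have := Finset.mem_range.1 hr; omega
      rw [hr', pow_succ', mul_smul_comm]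
      simp only [mul_assoc]
    have hr : twistedAd b p a t w * a = ∑ r ∈ Finset.range (t + 1),
        ((-1) ^ r * gaussCoeff p t r * b ^ r) • (a ^ (t - r) * w * a ^ (r + 1)) := by
      rw [ih, Finset.sum_mul]
      refine Finset.sum_congr rfl fun r _ => ?_
      rw [smul_mul_assoc, pow_succ a r, mul_assoc _ (a ^ r) a]
    rw [twistedAd, hl, hr, Finset.sum_range_succ' _ (t + 1), Finset.sum_range_succ' _ (t + 1),
      Finset.smul_sum, add_sub_right_comm, ← Finset.sum_sub_distrib, gaussCoeff_zero_right,
      gaussCoeff_zero_right]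
    congr 1
    refine Finset.sum_congr rfl fun r _ => ?_
    rw [smul_smul, Nat.add_sub_add_right, ← sub_smul, gaussCoeff]
    congr 1
    ring

theorem mul_twistedAd {b p β π : F} {k a w : R} (hw : k * w = β • (w * k))
    (ha : k * a = π • (a * k)) (t : ℕ) :
    k * twistedAd b p a t w = (β * π ^ t) • (twistedAd b p a t w * k) := by
  induction t with
  | zero => simpa [twistedAd] using hw
  | succ t ih =>
    rw [twistedAd]
    set x := twistedAd b p a t w
    have h1 : k * (a * x) = (β * π ^ (t + 1)) • (a * x * k) := by
      rw [← mul_assoc, ha, smul_mul_assoc, mul_assoc, ih, mul_smul_comm, smul_smul, mul_assoc]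
      congr 1; ring
    have h2 : k * (x * a) = (β * π ^ (t + 1)) • (x * a * k) := by
      rw [← mul_assoc, ih, smul_mul_assoc, mul_assoc, ha, mul_smul_comm, smul_smul, ← mul_assoc]
      congr 1; ring
    rw [mul_sub, mul_smul_comm, h1, h2, sub_mul, smul_mul_assoc, smul_sub, smul_comm]

theorem mul_pow_of_mul_eq_smul {p : F} {e k : R} (h : e * k = p • (k * e)) (t : ℕ) :
    e * k ^ t = p ^ t • (k ^ t * e) := by
  induction t with
  | zero => simp
  | succ t ih =>
    rw [pow_succ, ← mul_assoc, ih, smul_mul_assoc, mul_assoc, h, mul_smul_comm, smul_smul,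
      ← mul_assoc, pow_succ]

theorem twistedAd_sub_of_commute {b p : F} {k e w : R} (hek : e * k = p • (k * e))
    (hew : e * w = b • (w * e)) (hkw : k * w = w * k) (t : ℕ) :
    twistedAd b p (k - e) t w = (∏ s ∈ Finset.range t, (1 - b * p ^ s)) • (k ^ t * w) := by
  induction t with
  | zero => simp [twistedAd]
  | succ t ih =>
    have h1 : e * (k ^ t * w) = (b * p ^ t) • (k ^ t * w * e) := by
      rw [← mul_assoc, mul_pow_of_mul_eq_smul hek, smul_mul_assoc, mul_assoc, hew, mul_smul_comm,
        smul_smul, mul_assoc, mul_comm b]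
    have h2 : k * (k ^ t * w) = k ^ (t + 1) * w := by rw [← mul_assoc, pow_succ']
    have h3 : k ^ t * w * k = k ^ (t + 1) * w := by rw [mul_assoc, ← hkw, ← mul_assoc, pow_succ]
    rw [twistedAd, ih, Finset.prod_range_succ, mul_smul_comm, smul_mul_assoc,
      smul_comm (b * p ^ t), ← smul_sub, mul_smul (Finset.prod _ _)]
    congr 1
    rw [sub_mul, mul_sub, h1, h2, h3, smul_sub, sub_smul, one_smul]
    abel

theorem twistedAd_sub_of_twisted {b p : F} {k e w : R} (hke : k * e = p • (e * k))
    (hkw : k * w = b • (w * k)) (t : ℕ) :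
    twistedAd b p (k - e) t w = (-1 : F) ^ t • twistedAd b p e t w := by
  induction t with
  | zero => simp [twistedAd]
  | succ t ih =>
    have h := mul_twistedAd (b := b) (p := p) hkw hke t
    rw [twistedAd, ih, twistedAd, mul_smul_comm, smul_mul_assoc, smul_comm (b * p ^ t),
      ← smul_sub, pow_succ, mul_smul ((-1 : F) ^ t)]
    congr 1
    rw [sub_mul, mul_sub, h, smul_sub, neg_one_smul]
    abel

theorem exists_twistedAd_mul_eq_smul {b p α π : F} (hα : α ≠ 0) (hπ : π ≠ 0) {k l n w : R}
    (hkl : k * l = l * k) (hnk : n * k = π • (k * n)) (hnl : n * l = α • (l * n))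
    (hwk : w * k = α • (k * w)) (t : ℕ) :
    ∃ c : F, c ≠ 0 ∧
      twistedAd b p (k * n) t (l * w) = c • (k ^ t * l * twistedAd b p n t w) := by
  induction t with
  | zero => exact ⟨1, one_ne_zero, by simp [twistedAd]⟩
  | succ t ih =>
    obtain ⟨c, hc, ih⟩ := ih
    refine ⟨c * (α * π ^ t), mul_ne_zero hc (mul_ne_zero hα (pow_ne_zero t hπ)), ?_⟩
    have hkw : k * w = α⁻¹ • (w * k) := by rw [hwk, smul_smul, inv_mul_cancel₀ hα, one_smul]
    have hkn : k * n = π⁻¹ • (n * k) := by rw [hnk, smul_smul, inv_mul_cancel₀ hπ, one_smul]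
    have hX : twistedAd b p n t w * k = (α * π ^ t) • (k * twistedAd b p n t w) := by
      rw [mul_twistedAd hkw hkn t, smul_smul]
      have : α * π ^ t * (α⁻¹ * π⁻¹ ^ t) = 1 := by rw [inv_pow]; field_simp
      rw [this, one_smul]
    rw [twistedAd, ih, twistedAd]
    set x := twistedAd b p n t w
    have h1 : k * n * (k ^ t * l * x) = (α * π ^ t) • (k ^ (t + 1) * l * (n * x)) := by
      have : n * (k ^ t * l) = (α * π ^ t) • (k ^ t * l * n) := by
        rw [← mul_assoc, mul_pow_of_mul_eq_smul hnk, smul_mul_assoc, mul_assoc, hnl, mul_smul_comm,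
          smul_smul, mul_assoc, mul_comm α]
      rw [mul_assoc k, ← mul_assoc n, this, smul_mul_assoc, mul_smul_comm, pow_succ']
      simp only [mul_assoc]
    have h2 : k ^ t * l * x * (k * n) = (α * π ^ t) • (k ^ (t + 1) * l * (x * n)) := by
      rw [← mul_assoc, mul_assoc _ x k, hX, mul_smul_comm, smul_mul_assoc, pow_succ,
        mul_assoc _ k l, hkl]
      simp only [mul_assoc]
    rw [mul_smul_comm, smul_mul_assoc, smul_comm (b * p ^ t) c, ← smul_sub, mul_smul c, h1, h2,
      smul_comm (b * p ^ t), ← smul_sub, mul_sub, mul_smul_comm]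

theorem mul_one_sub_mul_eq_smul {c : F} {x y y' z : R} (hxy : x * y = y * x) (hy : y * y' = 1)
    (h : x * z - c • (z * x) = (1 - c) • (x * y')) :
    x * (1 - y * z) = c • ((1 - y * z) * x) := by
  have h1 : y * (x * y') = x := by rw [← mul_assoc, ← hxy, mul_assoc, hy, mul_one]
  rw [mul_sub, ← mul_assoc, hxy, mul_assoc, sub_eq_iff_eq_add.1 h, mul_add, mul_smul_comm,
    mul_smul_comm, h1, sub_mul, smul_sub, sub_smul, mul_one, one_mul, one_smul, ← mul_assoc]
  abel

end TwistedCommutator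

section GaussianBinomial

theorem qi_ne_zero (K : Type) [Field K] (di : ℕ) : qi K di ≠ 0 :=
  pow_ne_zero _ RatFunc.X_ne_zero

theorem qi_pow_ne_one (K : Type) [Field K] {di m : ℕ} (hd : 0 < di) (hm : 0 < m) :
    qi K di ^ m ≠ 1 := by
  rw [qi, qv, ← pow_mul, ← RatFunc.algebraMap_X, ← map_pow,
    ← map_one (algebraMap (Polynomial K) (RatFunc K))]
  intro h
  have h' := congrArg Polynomial.natDegree (RatFunc.algebraMap_injective K h)
  rw [Polynomial.natDegree_X_pow, Polynomial.natDegree_one] at h'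
  exact (Nat.mul_pos hd hm).ne' h'

theorem qi_sub_inv_ne_zero (K : Type) [Field K] {di : ℕ} (hd : 0 < di) :
    qi K di - (qi K di)⁻¹ ≠ 0 := by
  intro h
  apply qi_pow_ne_one K hd two_pos
  have h0 := qi_ne_zero K di
  field_simp at h
  linear_combination h

theorem qnum_succ_ne_zero (K : Type) [Field K] {di : ℕ} (hd : 0 < di) (m : ℕ) :
    qnum K di (m + 1) ≠ 0 := by
  refine div_ne_zero ?_ (qi_sub_inv_ne_zero K hd)
  intro h
  apply qi_pow_ne_one K hd (show 0 < 2 * (m + 1) by omega)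
  have h0 := qi_ne_zero K di
  have h1 : qi K di ^ ((m : ℤ) + 1) = qi K di ^ (m + 1) := by norm_cast
  rw [zpow_neg, h1] at h
  field_simp at h
  rw [mul_comm, pow_mul]
  linear_combination h

theorem qfac_ne_zero (K : Type) [Field K] {di : ℕ} (hd : 0 < di) (m : ℕ) : qfac K di m ≠ 0 := by
  induction m with
  | zero => exact one_ne_zero
  | succ m ih => exact mul_ne_zero (qnum_succ_ne_zero K hd m) ih

theorem qbin_zero_right (K : Type) [Field K] {di : ℕ} (hd : 0 < di) (t : ℕ) :
    qbin K di t 0 = 1 := by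
  simp [qbin, qfac, qfac_ne_zero K hd t]

theorem qbin_self (K : Type) [Field K] {di : ℕ} (hd : 0 < di) (t : ℕ) : qbin K di t t = 1 := by
  simp [qbin, qfac, qfac_ne_zero K hd t]

theorem qnum_add (K : Type) [Field K] {di : ℕ} {u : Kq K} (hu : u = qi K di ∨ u = (qi K di)⁻¹)
    (a b : ℤ) : qnum K di (a + b) = u ^ (-b) * qnum K di a + u ^ a * qnum K di b := by
  have h0 := qi_ne_zero K di
  rcases hu with rfl | rfl <;> simp only [qnum, inv_zpow', mul_div_assoc', ← add_div] <;> congr 1 <;>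
    simp only [mul_sub, ← zpow_add₀ h0] <;> ring_nf

theorem qbin_succ_succ (K : Type) [Field K] {di : ℕ} (hd : 0 < di) {u : Kq K}
    (hu : u = qi K di ∨ u = (qi K di)⁻¹) {t r : ℕ} (h : r < t) :
    qbin K di (t + 1) (r + 1) =
      u ^ (-((r : ℤ) + 1)) * qbin K di t (r + 1) + u ^ ((t : ℤ) - r) * qbin K di t r := by
  obtain ⟨s, rfl⟩ := Nat.exists_eq_add_of_lt h
  have e1 : r + s + 1 + 1 - (r + 1) = s + 1 := by omega
  have e2 : r + s + 1 - (r + 1) = s := by omega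
  have e3 : r + s + 1 - r = s + 1 := by omega
  have key := qnum_add K hu ((s : ℤ) + 1) ((r : ℤ) + 1)
  have c1 : ((r + s + 1 : ℕ) : ℤ) + 1 = (s : ℤ) + 1 + (r + 1) := by push_cast; ring
  have c2 : ((r + s + 1 : ℕ) : ℤ) - r = (s : ℤ) + 1 := by push_cast; ring
  have f1 := qfac_ne_zero K hd r
  have f2 := qfac_ne_zero K hd s
  have f3 := qnum_succ_ne_zero K hd r
  have f4 := qnum_succ_ne_zero K hd s
  rw [qbin, qbin, qbin, e1, e2, e3, c2, qfac, c1, key, qfac.eq_2 K di r, qfac.eq_2 K di s]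
  field_simp

theorem gaussCoeff_eq_qbin (K : Type) [Field K] {di : ℕ} (hd : 0 < di) {u : Kq K}
    (hu : u = qi K di ∨ u = (qi K di)⁻¹) {t r : ℕ} (h : r ≤ t) :
    gaussCoeff (u ^ 2) t r = u ^ ((r : ℤ) * ((t : ℤ) - 1)) * qbin K di t r := by
  have h0 : u ≠ 0 := by
    rcases hu with rfl | rfl
    · exact qi_ne_zero K di
    · exact inv_ne_zero (qi_ne_zero K di)
  induction t generalizing r with
  | zero =>
    obtain rfl : r = 0 := by omega
    simp [gaussCoeff, qbin_self K hd]
  | succ t ih =>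
    cases r with
    | zero => simp [gaussCoeff, qbin_zero_right K hd]
    | succ r =>
      rw [gaussCoeff, ih (r := r) (by omega)]
      have hp : (u ^ 2) ^ t = u ^ (2 * (t : ℤ)) := by
        rw [← pow_mul]; norm_cast
      rcases Nat.lt_or_ge r t with hr | hr
      · rw [ih (r := r + 1) (by omega), qbin_succ_succ K hd hu hr, mul_add, hp, ← mul_assoc,
          ← mul_assoc, ← mul_assoc, ← zpow_add₀ h0, ← zpow_add₀ h0, ← zpow_add₀ h0]
        push_cast
        ring_nf
      · obtain rfl : r = t := by omega
        rw [gaussCoeff_eq_zero _ (Nat.lt_succ_self r), qbin_self K hd, qbin_self K hd, hp, zero_add,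
          mul_one, mul_one, ← zpow_add₀ h0]
        push_cast
        ring_nf

/-- The quantum Serre sum is an iterated twisted commutator, in either order of the factors. -/
theorem twistedAd_eq_serre_sum (K : Type) [Field K] {R : Type*} [Ring R] [Algebra (Kq K) R]
    {di : ℕ} (hd : 0 < di) {u : Kq K} (hu : u = qi K di ∨ u = (qi K di)⁻¹) (m : ℕ) (a w : R) :
    twistedAd (u ^ (1 - (m : ℤ))) (u ^ 2) a m w = ∑ r ∈ Finset.range (m + 1),
      ((-1 : Kq K) ^ r * qbin K di m r) • (a ^ (m - r) * w * a ^ r) := by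
  have h0 : u ≠ 0 := by
    rcases hu with rfl | rfl
    · exact qi_ne_zero K di
    · exact inv_ne_zero (qi_ne_zero K di)
  rw [twistedAd_eq_sum]
  refine Finset.sum_congr rfl fun r hr => ?_
  rw [gaussCoeff_eq_qbin K hd hu (Nat.lt_succ_iff.1 (Finset.mem_range.1 hr))]
  congr 1
  have : u ^ ((r : ℤ) * ((m : ℤ) - 1)) * (u ^ (1 - (m : ℤ))) ^ r = 1 := by
    rw [← zpow_natCast, ← zpow_mul, ← zpow_add₀ h0]
    ring_nf
    simp
  linear_combination ((-1 : Kq K) ^ r * qbin K di m r) * this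

end GaussianBinomial

section EquitableRelations

variable (K : Type) [Field K] {n : ℕ} (A : Matrix (Fin n) (Fin n) ℤ) (d : Fin n → ℕ)

theorem genX_mul_genXinv (i : Fin n) : genX K A d i * genXinv K A d i = 1 := by
  simpa [genX, genXinv] using RingQuot.mkAlgHom_rel (Kq K) (ERel.E1a (K := K) (A := A) (d := d) i)

theorem genXinv_mul_genX (i : Fin n) : genXinv K A d i * genX K A d i = 1 := by
  simpa [genX, genXinv] using RingQuot.mkAlgHom_rel (Kq K) (ERel.E1b (K := K) (A := A) (d := d) i)

theorem genX_mul_genX (i j : Fin n) :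
    genX K A d i * genX K A d j = genX K A d j * genX K A d i := by
  simpa [genX] using RingQuot.mkAlgHom_rel (Kq K) (ERel.E2 (K := K) (A := A) (d := d) i j)

theorem genX_mul_genZ (i j : Fin n) :
    genX K A d i * genZ K A d j - qi K (d i) ^ A i j • (genZ K A d j * genX K A d i) =
      (1 - qi K (d i) ^ A i j) • (genX K A d i * genXinv K A d j) := by
  have h := RingQuot.mkAlgHom_rel (Kq K) (ERel.E4 (K := K) (A := A) (d := d) i j)
  simp only [map_sub, map_mul, map_smul] at h
  exact h

theorem genZ_serre_sum (i j : Fin n) (hij : i ≠ j) :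
    ∑ r ∈ Finset.range ((1 - A i j).toNat + 1),
        ((-1 : Kq K) ^ r * qbin K (d i) (1 - A i j).toNat r) •
          (genZ K A d i ^ ((1 - A i j).toNat - r) * genZ K A d j * genZ K A d i ^ r) =
      (∏ s ∈ Finset.range ((-(A i j)).toNat + 1), (1 - qi K (d i) ^ (A i j + 2 * (s : ℤ)))) •
        (genXinv K A d i ^ (1 - A i j).toNat * genXinv K A d j) := by
  have h := RingQuot.mkAlgHom_rel (Kq K) (ERel.E8 (K := K) (A := A) (d := d) i j hij)
  simp only [map_sum, map_mul, map_smul, map_pow] at h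
  exact h

theorem genXinv_mul_genXinv (i j : Fin n) :
    genXinv K A d i * genXinv K A d j = genXinv K A d j * genXinv K A d i := by
  let x (l : Fin n) : (Ueqg K A d)ˣ :=
    ⟨genX K A d l, genXinv K A d l, genX_mul_genXinv K A d l, genXinv_mul_genX K A d l⟩
  have h : Commute (x i) (x j) := Units.ext (genX_mul_genX K A d i j)
  exact congrArg Units.val h.inv_inv.eq

theorem genX_mul_one_sub (i j : Fin n) :
    genX K A d i * (1 - genX K A d j * genZ K A d j) =
      qi K (d i) ^ A i j • ((1 - genX K A d j * genZ K A d j) * genX K A d i) :=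
  mul_one_sub_mul_eq_smul (genX_mul_genX K A d i j) (genX_mul_genXinv K A d j)
    (genX_mul_genZ K A d i j)

theorem one_sub_mul_genXinv (i j : Fin n) :
    (1 - genX K A d j * genZ K A d j) * genXinv K A d i =
      qi K (d i) ^ A i j • (genXinv K A d i * (1 - genX K A d j * genZ K A d j)) := by
  have h := congrArg (fun y => genXinv K A d i * y * genXinv K A d i) (genX_mul_one_sub K A d i j)
  simp only [mul_smul_comm, smul_mul_assoc] at h
  rw [← mul_assoc, genXinv_mul_genX, one_mul, mul_assoc, mul_assoc, genX_mul_genXinv, mul_one] at h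
  exact h

end EquitableRelations

/-- In the equitable algebra `U`, for `i ≠ j`,
`Σ_{r=0}^{1-A_ij} (-1)^r [1-A_ij choose r]_i (1-X_iZ_i)^{1-A_ij-r} (1-X_jZ_j) (1-X_iZ_i)^r = 0`. -/
theorem equitable_serre_sum_XZ (K : Type) [Field K] {n : ℕ}
    (A : Matrix (Fin n) (Fin n) ℤ) (d : Fin n → ℕ) (hA : IsSymmetrizableGCM A d)
    (i j : Fin n) (hij : i ≠ j) :
    ∑ r ∈ Finset.range ((1 - A i j).toNat + 1),
      ((-1 : Kq K) ^ r * qbin K (d i) (1 - A i j).toNat r) •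
        ((1 - genX K A d i * genZ K A d i) ^ ((1 - A i j).toNat - r) *
          (1 - genX K A d j * genZ K A d j) *
          (1 - genX K A d i * genZ K A d i) ^ r) = 0 := by
  obtain ⟨-, hdiag, hnonpos, hd, -, hsymm⟩ := hA
  set v := qi K (d i) with hv
  have hv0 : v ≠ 0 := qi_ne_zero K (d i)
  set m := (1 - A i j).toNat with hm
  have hmA : (m : ℤ) = 1 - A i j := Int.toNat_of_nonneg (by have := hnonpos i j hij; omega)
  set k := genXinv K A d i
  set l := genXinv K A d j
  set N := 1 - genX K A d i * genZ K A d i with hN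
  set M := 1 - genX K A d j * genZ K A d j with hM
  have hZi : genZ K A d i = k - k * N := by
    rw [hN, mul_sub, ← mul_assoc, genXinv_mul_genX]; simp
  have hZj : genZ K A d j = l - l * M := by
    rw [hM, mul_sub, ← mul_assoc, genXinv_mul_genX]; simp
  have hkl : k * l = l * k := genXinv_mul_genXinv K A d i j
  have hNk : N * k = v ^ 2 • (k * N) := by
    have h := one_sub_mul_genXinv K A d i i
    rw [hdiag] at h
    exact_mod_cast h
  have hMk : M * k = v ^ A i j • (k * M) := one_sub_mul_genXinv K A d i j
  have hqsymm : qi K (d j) ^ A j i = v ^ A i j := by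
    rw [hv, qi, qi, ← zpow_natCast, ← zpow_natCast, ← zpow_mul, ← zpow_mul, hsymm]
  have hNl : N * l = v ^ A i j • (l * N) := hqsymm ▸ one_sub_mul_genXinv K A d j i
  have hvA : v ^ A i j ≠ 0 := zpow_ne_zero _ hv0
  have hek : k * N * k = v ^ 2 • (k * (k * N)) := by rw [mul_assoc, hNk, mul_smul_comm]
  have hel : k * N * l = v ^ A i j • (l * (k * N)) := by
    rw [mul_assoc, hNl, mul_smul_comm, ← mul_assoc, hkl, mul_assoc]
  have hke : k * (k * N) = v⁻¹ ^ 2 • (k * N * k) := by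
    rw [hek, smul_smul, inv_pow, inv_mul_cancel₀ (pow_ne_zero 2 hv0), one_smul]
  have hkf : k * (l * M) = v⁻¹ ^ A i j • (l * M * k) := by
    rw [mul_assoc l, hMk, mul_smul_comm, smul_smul, inv_zpow, inv_mul_cancel₀ hvA, one_smul,
      ← mul_assoc, hkl, mul_assoc]
  have hb : 1 - (m : ℤ) = A i j := by rw [hmA]; ring
  have ad_v := twistedAd_eq_serre_sum K (R := Ueqg K A d) (hd i) (Or.inl rfl) m
  have ad_vinv := twistedAd_eq_serre_sum K (R := Ueqg K A d) (hd i) (Or.inr rfl) m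
  rw [hb, ← hv] at ad_v ad_vinv
  have hS := genZ_serre_sum K A d i j hij
  rw [← hm, ← hv, hZi, hZj] at hS
  simp only [mul_sub (_ ^ _), sub_mul _ _ (_ ^ _), smul_sub, Finset.sum_sub_distrib] at hS
  rw [← ad_v, ← ad_vinv, twistedAd_sub_of_commute hek hel hkl,
    twistedAd_sub_of_twisted hke hkf] at hS
  have hprod : ∏ s ∈ Finset.range ((-(A i j)).toNat + 1), (1 - v ^ (A i j + 2 * (s : ℤ))) =
      ∏ s ∈ Finset.range m, (1 - v ^ A i j * (v ^ 2) ^ s) := by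
    have : (-(A i j)).toNat + 1 = m := by
      have h := hnonpos i j hij
      clear_value m
      generalize A i j = x at *
      omega
    rw [this]
    refine Finset.prod_congr rfl fun s _ => ?_
    rw [zpow_add₀ hv0, ← pow_mul]
    norm_cast
  rw [hprod, sub_eq_self, smul_eq_zero_iff_right (pow_ne_zero _ (neg_ne_zero.2 one_ne_zero)),
    ad_vinv, ← ad_v] at hS
  obtain ⟨c, hc, h⟩ := exists_twistedAd_mul_eq_smul (b := v ^ A i j) (p := v ^ 2) hvA
    (pow_ne_zero 2 hv0) hkl hNk hNl hMk m
  rw [hS, eq_comm, smul_eq_zero_iff_right hc] at h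
  rw [← ad_v]
  have hx := congrArg (fun y => genX K A d i ^ m * (genX K A d j * y)) h
  have hinv : genX K A d i ^ m * k ^ m = 1 := by
    have hc : Commute (genX K A d i) k :=
      (genX_mul_genXinv K A d i).trans (genXinv_mul_genX K A d i).symm
    rw [← hc.mul_pow, genX_mul_genXinv, one_pow]
  have hcomm : k ^ m * l = l * k ^ m := (show Commute k l from hkl).pow_left m
  simp only [mul_zero] at hx
  rwa [hcomm, mul_assoc, ← mul_assoc (genX K A d j), genX_mul_genXinv, one_mul, ← mul_assoc, hinv,
    one_mul] at hx
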